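/- Let R be a principal ideal domain and L a graded Lie algebra over R (with squaring operation on odd-degree classes) such that each graded piece L_n is a finitely generated free R-module. Then the natural map ι: L → U(L) into the universal enveloping algebra is injective. -/

import Mathlib

noncomputable section

/-- The defining relations of the universal enveloping algebra of a graded Lie algebra
(with squaring operation) whose underlying module is `M`, graded by `g`, with bracket `β`
and squaring `sq`: for homogeneous `x, y` one imposes
`x⊗y − (−1)^{|x||y|} y⊗x = [x,y]`, and `x⊗x = x²` for `x` of odd degree. -/
def gradedUEARel (R : Type*) [CommRing R] (M : Type*) [AddCommGroup M] [Module R M]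
    (g : ℕ → Submodule R M) (β : M →ₗ[R] M →ₗ[R] M) (sq : M → M) :
    TensorAlgebra R M → TensorAlgebra R M → Prop := fun x y =>
  (∃ (i j : ℕ) (a b : M), a ∈ g i ∧ b ∈ g j ∧
      x = TensorAlgebra.ι R a * TensorAlgebra.ι R b -
        ((-1 : ℤ) ^ (i * j)) • (TensorAlgebra.ι R b * TensorAlgebra.ι R a) ∧
      y = TensorAlgebra.ι R (β a b)) ∨
  (∃ (k : ℕ) (a : M), a ∈ g (2 * k + 1) ∧
      x = TensorAlgebra.ι R a * TensorAlgebra.ι R a ∧ y = TensorAlgebra.ι R (sq a))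

set_option linter.unusedSectionVars false

structure PBWData (R : Type*) [CommRing R] (M : Type*) [AddCommGroup M] [Module R M]
    (I : Type*) where
  b : Module.Basis I R M
  d : I → ℕ
  g : ℕ → Submodule R M
  β : M →ₗ[R] M →ₗ[R] M
  sq : M → M
  hbg : ∀ i, b i ∈ g (d i)
  hspan : ∀ n, ∀ x ∈ g n, x ∈ Submodule.span R {y | ∃ i, d i = n ∧ b i = y}
  hβg : ∀ i j, ∀ x ∈ g i, ∀ y ∈ g j, β x y ∈ g (i + j)
  hsqg : ∀ k, ∀ x ∈ g (2 * k + 1), sq x ∈ g (4 * k + 2)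
  hanti : ∀ i j, ∀ x ∈ g i, ∀ y ∈ g j, β x y = -(((-1 : ℤ) ^ (i * j)) • β y x)
  hjac : ∀ i j, ∀ x ∈ g i, ∀ y ∈ g j, ∀ z : M,
      β x (β y z) = β (β x y) z + ((-1 : ℤ) ^ (i * j)) • β y (β x z)
  hsq_smul : ∀ k (a : R), ∀ x ∈ g (2 * k + 1), sq (a • x) = (a * a) • sq x
  hsq_add : ∀ k, ∀ x ∈ g (2 * k + 1), ∀ y ∈ g (2 * k + 1),
      sq (x + y) = sq x + sq y + β x y
  htwo_sq : ∀ k, ∀ x ∈ g (2 * k + 1), (2 : ℤ) • sq x = β x x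
  hbr_sq_self : ∀ k, ∀ x ∈ g (2 * k + 1), β x (sq x) = 0
  heven_self : ∀ i, ∀ x ∈ g (2 * i), β x x = 0
  hbr_sq : ∀ k j, ∀ x ∈ g (2 * k + 1), ∀ y ∈ g j, β y (sq x) = β (β y x) x

namespace PBWData

variable {R : Type*} [CommRing R] {M : Type*} [AddCommGroup M] [Module R M]
  {I : Type*} [LinearOrder I] (D : PBWData R M I) {P : Type*} [AddCommGroup P] [Module R P]

abbrev e (i : I) : TensorAlgebra R M := TensorAlgebra.ι R (D.b i)

def W (w : List I) : TensorAlgebra R M := (w.map D.e).prod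

lemma W_append (u v : List I) : D.W (u ++ v) = D.W u * D.W v := by simp [W]
lemma W_cons (i : I) (v : List I) : D.W (i :: v) = D.e i * D.W v := by simp [W]
lemma W_nil : D.W [] = 1 := by simp [W]

def bad (i j : I) : Prop := j < i ∨ (i = j ∧ Odd (D.d i))

def q (i j : I) : TensorAlgebra R M :=
  if i = j then TensorAlgebra.ι R (D.sq (D.b i)) else
    ((-1 : ℤ) ^ (D.d i * D.d j)) • (D.e j * D.e i) + TensorAlgebra.ι R (D.β (D.b i) (D.b j))

lemma basis_apply (w : List I) : D.b.tensorAlgebra (FreeMonoid.ofList w) = D.W w := by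
  rw [Module.Basis.tensorAlgebra]
  simp only [Module.Basis.map_apply]
  have : (FreeAlgebra.basisFreeMonoid R I) (FreeMonoid.ofList w)
      = (w.map (FreeAlgebra.ι R)).prod := by
    simp [FreeAlgebra.basisFreeMonoid, FreeAlgebra.equivMonoidAlgebraFreeMonoid]
  rw [this]
  simp [W, map_list_prod, Function.comp_def]

lemma lin_ext {F G : TensorAlgebra R M →ₗ[R] P} (h : ∀ w, F (D.W w) = G (D.W w)) : F = G :=
  D.b.tensorAlgebra.ext fun w => by
    have := h (FreeMonoid.toList w)
    rwa [← basis_apply] at this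

def ext (f : List I → P) : TensorAlgebra R M →ₗ[R] P :=
  D.b.tensorAlgebra.constr ℕ (fun w => f (FreeMonoid.toList w))

lemma ext_W (f : List I → P) (w : List I) : D.ext f (D.W w) = f w := by
  rw [← basis_apply, ext, Module.Basis.constr_basis]; rfl

/-- the restriction of `F` to words with fixed prefix and suffix -/
def sand (F : TensorAlgebra R M →ₗ[R] P) (x y : TensorAlgebra R M) :
    TensorAlgebra R M →ₗ[R] P :=
  F ∘ₗ LinearMap.mulLeft R x ∘ₗ LinearMap.mulRight R y

lemma sand_apply (F : TensorAlgebra R M →ₗ[R] P) (x y t : TensorAlgebra R M) :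
    sand F x y t = F (x * (t * y)) := rfl

lemma ι_congr {F G : TensorAlgebra R M →ₗ[R] P} (h : ∀ m, F (D.e m) = G (D.e m)) (x : M) :
    F (TensorAlgebra.ι R x) = G (TensorAlgebra.ι R x) :=
  LinearMap.congr_fun (D.b.ext (f₁ := F ∘ₗ TensorAlgebra.ι R)
    (f₂ := G ∘ₗ TensorAlgebra.ι R) h) x

lemma agree (G₁ G₂ : TensorAlgebra R M →ₗ[R] P) (u v : List I) (i j : I) (hb : D.bad i j)
    (h1 : ∀ m, G₁ (D.W (u ++ m :: v)) = G₂ (D.W (u ++ m :: v)))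
    (h2 : j < i → G₁ (D.W (u ++ j :: i :: v)) = G₂ (D.W (u ++ j :: i :: v))) :
    G₁ (D.W u * (D.q i j * D.W v)) = G₂ (D.W u * (D.q i j * D.W v)) := by
  have key : ∀ x, G₁ (D.W u * (TensorAlgebra.ι R x * D.W v))
      = G₂ (D.W u * (TensorAlgebra.ι R x * D.W v)) := fun x =>
    D.ι_congr (F := sand G₁ (D.W u) (D.W v)) (G := sand G₂ (D.W u) (D.W v)) (fun m => by
      simpa only [sand_apply, W_append, W_cons] using h1 m) x
  unfold q
  split_ifs with h
  · exact key _
  · have hji : j < i := hb.resolve_right fun h' => h h'.1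
    have h2' := h2 hji
    simp only [W_append, W_cons] at h2'
    simp only [add_mul, mul_add, map_add, key, smul_mul_assoc, mul_smul_comm, map_zsmul,
      mul_assoc, h2']

lemma sq_zero : D.sq 0 = 0 := by
  simpa using D.hsq_smul 0 0 0 (Submodule.zero_mem _)

lemma comm_of (F : TensorAlgebra R M →ₗ[R] P)
    (hF : ∀ i j, D.bad i j → F (D.e i * D.e j) = F (D.q i j))
    (m n : ℕ) (x y : M) (hx : x ∈ D.g m) (hy : y ∈ D.g n) :
    F (TensorAlgebra.ι R x * TensorAlgebra.ι R y) =
      ((-1 : ℤ) ^ (m * n)) • F (TensorAlgebra.ι R y * TensorAlgebra.ι R x)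
        + F (TensorAlgebra.ι R (D.β x y)) := by
  replace hx := D.hspan m x hx
  replace hy := D.hspan n y hy
  induction hx using Submodule.span_induction with
  | zero => simp
  | add x x' _ _ h h' =>
    simp only [map_add, add_mul, mul_add, h, h', smul_add, LinearMap.add_apply]; abel
  | smul a x _ h =>
    simp only [map_smul, smul_mul_assoc, mul_smul_comm, h, smul_add, LinearMap.smul_apply]
    rw [smul_comm]
  | mem x hx =>
  obtain ⟨i, rfl, rfl⟩ := hx
  induction hy using Submodule.span_induction with
  | zero => simp
  | add x x' _ _ h h' =>
    simp only [map_add, add_mul, mul_add, h, h', smul_add]; abel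
  | smul a x _ h =>
    simp only [map_smul, smul_mul_assoc, mul_smul_comm, h, smul_add]
    rw [smul_comm]
  | mem y hy =>
  obtain ⟨j, rfl, rfl⟩ := hy
  rcases lt_trichotomy j i with h | h | h
  · have := hF i j (Or.inl h)
    rw [this, q, if_neg h.ne', map_add, map_zsmul]
  · subst h
    rcases Nat.even_or_odd (D.d j) with ho | ho
    · obtain ⟨k, hk⟩ := ho
      have : D.β (D.b j) (D.b j) = 0 := D.heven_self k _ (by
        have := D.hbg j; rwa [hk, ← two_mul] at this)
      rw [this, Even.neg_one_pow (Even.mul_left ⟨k, hk⟩ _)]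
      simp
    · have h1 := hF j j (Or.inr ⟨rfl, ho⟩)
      rw [h1, q, if_pos rfl, Odd.neg_one_pow (ho.mul ho)]
      obtain ⟨k, hk⟩ := ho
      have := D.htwo_sq k (D.b j) (hk ▸ D.hbg j)
      rw [← this]
      simp [two_smul]
  · have := hF j i (Or.inl h)
    rw [this, q, if_neg h.ne', map_add, map_zsmul,
      D.hanti _ _ _ (D.hbg i) _ (D.hbg j), smul_add, smul_smul, mul_comm (D.d j), ← mul_pow,
      map_neg, map_zsmul, map_neg, map_zsmul]
    simp only [mul_neg, mul_one, neg_neg, one_pow, one_smul]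
    abel

lemma sq_of (F : TensorAlgebra R M →ₗ[R] P)
    (hF : ∀ i j, D.bad i j → F (D.e i * D.e j) = F (D.q i j))
    (k : ℕ) (x : M) (hx : x ∈ D.g (2 * k + 1)) :
    F (TensorAlgebra.ι R x * TensorAlgebra.ι R x) = F (TensorAlgebra.ι R (D.sq x)) := by
  have hsp : Submodule.span R {y | ∃ i, D.d i = 2 * k + 1 ∧ D.b i = y} ≤ D.g (2 * k + 1) := by
    rw [Submodule.span_le]
    rintro _ ⟨i, hi, rfl⟩
    exact hi ▸ D.hbg i
  replace hx := D.hspan _ x hx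
  induction hx using Submodule.span_induction with
  | zero => simp [sq_zero]
  | add x y hx hy h h' =>
    rw [D.hsq_add k x (hsp hx) y (hsp hy)]
    have h3 := D.comm_of F hF _ _ x y (hsp hx) (hsp hy)
    rw [Odd.neg_one_pow (by exact Odd.mul ⟨k, rfl⟩ ⟨k, rfl⟩)] at h3
    simp only [map_add, add_mul, mul_add, h, h', h3]
    simp; abel
  | smul a x hx h =>
    rw [D.hsq_smul k a x (hsp hx)]
    simp only [map_smul, smul_mul_assoc, mul_smul_comm, h, smul_smul]
  | mem x hx =>
  obtain ⟨i, hi, rfl⟩ := hx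
  rw [hF i i (Or.inr ⟨rfl, k, hi⟩), q, if_pos rfl]

/-- Overlap ambiguities resolve. -/
lemma overlap (F : TensorAlgebra R M →ₗ[R] P)
    (hF : ∀ i j, D.bad i j → F (D.e i * D.e j) = F (D.q i j))
    (i j k : I) (hij : D.bad i j) (hjk : D.bad j k)
    (hL : ∀ a b c, (a < i ∨ (a = i ∧ b < j)) → D.bad a b →
      F (D.e a * (D.e b * D.e c)) = F (D.q a b * D.e c))
    (hR : ∀ a b c, (a < i ∨ (a = i ∧ b < j)) → D.bad b c →
      F (D.e a * (D.e b * D.e c)) = F (D.e a * D.q b c)) :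
    F (D.q i j * D.e k) = F (D.e i * D.q j k) := by
  have gi := D.hbg i
  have gj := D.hbg j
  have gk := D.hbg k
  have sg : ∀ n : ℕ, (-1 : ℤ) ^ n = 1 ∨ (-1 : ℤ) ^ n = -1 := neg_one_pow_eq_or ℤ
  rcases hij with hij | ⟨rfl, oi⟩
  · rcases hjk with hjk | ⟨rfl, oj⟩
    · have hik := hjk.trans hij
      have gij := D.hβg _ _ _ gi _ gj
      have gjk := D.hβg _ _ _ gj _ gk
      have gik := D.hβg _ _ _ gi _ gk
      have a1 := hR j i k (Or.inl hij) (Or.inl hik)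
      have a2 := hL j k i (Or.inl hij) (Or.inl hjk)
      have a3 := hL i k j (Or.inr ⟨rfl, hjk⟩) (Or.inl hik)
      have a4 := hR k i j (Or.inl hik) (Or.inl hij)
      have c1 := D.comm_of F hF _ _ _ _ gij gk
      have c2 := D.comm_of F hF _ _ _ _ gi gjk
      have c3 := D.comm_of F hF _ _ _ _ gj gik
      have J := D.hjac _ _ _ gi _ gj (D.b k)
      have J' := congrArg (fun x => F (TensorAlgebra.ι R x)) J
      simp only [q, if_neg hij.ne', if_neg hik.ne', if_neg hjk.ne', mul_add, add_mul, map_add,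
        smul_mul_assoc, mul_smul_comm, map_zsmul, mul_assoc, pow_add] at *
      rw [a1, a2, a3, a4, c1, c2, J', c3]
      rw [mul_comm (D.d j) (D.d i)]
      rcases sg (D.d i * D.d j) with s1 | s1 <;> rcases sg (D.d i * D.d k) with s2 | s2 <;>
        rcases sg (D.d j * D.d k) with s3 | s3 <;> simp only [s1, s2, s3] <;> simp <;> abel
    · have gij := D.hβg _ _ _ gi _ gj
      have a1 := hR j i j (Or.inl hij) (Or.inl hij)
      have a2 := hL j j i (Or.inl hij) (Or.inr ⟨rfl, oj⟩)
      have sjj := Odd.neg_one_pow (α := ℤ) (oj.mul oj)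
      obtain ⟨m, hm⟩ := oj
      have gj' := gj
      rw [hm] at gj'
      have gs := D.hsqg _ _ gj'
      have c1 := D.comm_of F hF _ _ _ _ gi gs
      have c2 := D.comm_of F hF _ _ _ _ gij gj
      rw [D.hbr_sq _ _ _ gj' _ gi, Even.neg_one_pow
        (by exact Even.mul_left ⟨2 * m + 1, by ring⟩ _)] at c1
      simp only [q, if_neg hij.ne', if_true, mul_add, add_mul, map_add,
        smul_mul_assoc, mul_smul_comm, map_zsmul, mul_assoc, pow_add] at *
      rw [a1, a2, c1, c2, sjj]
      rcases sg (D.d i * D.d j) with s1 | s1 <;> simp only [s1] <;> simp <;> abel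
  · rcases hjk with hik | ⟨rfl, -⟩
    · have gik := D.hβg _ _ _ gi _ gk
      have a1 := hL i k i (Or.inr ⟨rfl, hik⟩) (Or.inl hik)
      have a2 := hR k i i (Or.inl hik) (Or.inr ⟨rfl, oi⟩)
      have sii := Odd.neg_one_pow (α := ℤ) (oi.mul oi)
      obtain ⟨m, hm⟩ := oi
      have gi' := gi
      rw [hm] at gi'
      have gs := D.hsqg _ _ gi'
      have c1 := D.comm_of F hF _ _ _ _ gs gk
      have c2 := D.comm_of F hF _ _ _ _ gi gik
      have sev : (-1 : ℤ) ^ ((4 * m + 2) * D.d k) = 1 :=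
        Even.neg_one_pow (by exact Even.mul_right ⟨2 * m + 1, by ring⟩ _)
      have Z : D.β (D.sq (D.b i)) (D.b k) = D.β (D.b i) (D.β (D.b i) (D.b k)) := by
        rw [D.hanti _ _ _ gs _ gk, sev, D.hbr_sq _ _ _ gi' _ gk, D.hanti _ _ _ gk _ gi,
          D.hanti _ _ _ gi _ gik, mul_add, pow_add, sii, mul_comm (D.d k)]
        rcases sg (D.d i * D.d k) with s1 | s1 <;> simp only [s1] <;> simp
      rw [sev, Z] at c1
      simp only [q, if_neg hik.ne', if_true, mul_add, add_mul, map_add,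
        smul_mul_assoc, mul_smul_comm, map_zsmul, mul_assoc, pow_add] at *
      rw [a1, a2, c1, c2, sii]
      rcases sg (D.d i * D.d k) with s1 | s1 <;> simp only [s1] <;> simp <;> abel
    · obtain ⟨m, hm⟩ := oi
      have gi' := gi
      rw [hm] at gi'
      have gs := D.hsqg _ _ gi'
      have c1 := D.comm_of F hF _ _ _ _ gi gs
      rw [D.hbr_sq_self _ _ gi', Even.neg_one_pow
        (by exact Even.mul_left ⟨2 * m + 1, by ring⟩ _)] at c1
      simp only [q, if_true]
      rw [c1]; simp

/-! ### The normal form map -/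

abbrev lt' : List I → List I → Prop := List.Shortlex (· < ·)

def Dec (w : List I) : Prop := ∃ t : List I × I × I × List I,
  w = t.1 ++ t.2.1 :: t.2.2.1 :: t.2.2.2 ∧ D.bad t.2.1 t.2.2.1

open Classical in
def step (w : List I) (rec : ∀ v, lt' v w → TensorAlgebra R M) : TensorAlgebra R M :=
  if h : D.Dec w then
    D.ext (fun v => if hv : lt' v w then rec v hv else 0)
      (D.W h.choose.1 * (D.q h.choose.2.1 h.choose.2.2.1 * D.W h.choose.2.2.2))
  else D.W w

def nf [WellFoundedLT I] : List I → TensorAlgebra R M :=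
  (List.Shortlex.wf (r := ((· < ·) : I → I → Prop)) wellFounded_lt).fix D.step

lemma lt_len {u v : List I} (h : u.length < v.length) : lt' u v := List.Shortlex.of_length_lt h

lemma lt_cons (u : List I) {i j : I} (s t : List I) (h : i < j) (hl : s.length = t.length) :
    lt' (u ++ i :: s) (u ++ j :: t) :=
  List.Shortlex.append_left (List.Shortlex.of_lex (by simp [hl]) (List.Lex.rel h)) u

variable [WellFoundedLT I]

def N : TensorAlgebra R M →ₗ[R] TensorAlgebra R M := D.ext D.nf

lemma N_W (w : List I) : D.N (D.W w) = D.nf w := D.ext_W _ _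

lemma nf_of_not (w : List I) (h : ¬ D.Dec w) : D.nf w = D.W w := by
  rw [nf, WellFounded.fix_eq, step, dif_neg h]

lemma nf_of (w : List I) (h : D.Dec w) : ∃ u i j v, w = u ++ i :: j :: v ∧ D.bad i j ∧
    D.nf w = D.N (D.W u * (D.q i j * D.W v)) := by
  refine ⟨h.choose.1, h.choose.2.1, h.choose.2.2.1, h.choose.2.2.2, h.choose_spec.1,
    h.choose_spec.2, ?_⟩
  conv_lhs => rw [nf, WellFounded.fix_eq, step, dif_pos h]
  have hw := h.choose_spec.1
  have hb := h.choose_spec.2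
  generalize h.choose = t at hw hb
  obtain ⟨u, i, j, v⟩ := t
  simp only at hw hb ⊢
  apply D.agree _ _ _ _ _ _ hb
  · intro m
    rw [ext_W, N_W, dif_pos, nf]
    exact lt_len (by simp [hw])
  · intro hji
    rw [ext_W, N_W, dif_pos, nf]
    rw [hw]
    exact lt_cons _ _ _ hji (by simp)

/-- The reduction statement at the word `w`. -/
def Good (w : List I) : Prop := ∀ u i j v, w = u ++ i :: j :: v → D.bad i j →
  D.N (D.W w) = D.N (D.W u * (D.q i j * D.W v))

lemma confl (w : List I) (ih : ∀ w', lt' w' w → D.Good w') (u a v : List I) (i j k l : I)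
    (v' : List I)
    (hw : w = u ++ i :: j :: v) (hw' : i :: j :: v = a ++ k :: l :: v') (hij : D.bad i j)
    (hkl : D.bad k l) :
    D.N (D.W u * (D.q i j * D.W v)) = D.N (D.W (u ++ a) * (D.q k l * D.W v')) := by
  match a with
  | [] =>
    simp only [List.nil_append, List.cons.injEq] at hw'
    obtain ⟨rfl, rfl, rfl⟩ := hw'
    simp
  | [x] =>
    simp only [List.cons_append, List.nil_append, List.cons.injEq] at hw'
    obtain ⟨rfl, rfl, rfl⟩ := hw'
    have hF : ∀ a b, D.bad a b → sand D.N (D.W u) (D.W v') (D.e a * D.e b)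
        = sand D.N (D.W u) (D.W v') (D.q a b) := by
      intro a b hab
      have := ih (u ++ a :: b :: v') (lt_len (by simp [hw])) u a b v' rfl hab
      simpa only [sand_apply, W_append, W_cons, mul_assoc] using this
    have hlt : ∀ a b c, (a < i ∨ (a = i ∧ b < j)) → lt' (u ++ a :: b :: c :: v') w := by
      intro a b c h
      subst hw
      rcases h with h | ⟨rfl, h⟩
      · exact lt_cons _ _ _ h (by simp)
      · simpa using lt_cons (u ++ [a]) (c :: v') (l :: v') h (by simp)
    have := D.overlap (sand D.N (D.W u) (D.W v')) hF i j l hij hkl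
      (by
        intro a b c h hab
        have := ih _ (hlt a b c h) u a b (c :: v') rfl hab
        simpa only [sand_apply, W_append, W_cons, mul_assoc] using this)
      (by
        intro a b c h hab
        have := ih _ (hlt a b c h) (u ++ [a]) b c v' (by simp) hab
        simpa only [sand_apply, W_append, W_cons, W_nil, mul_one, mul_assoc] using this)
    simpa only [sand_apply, W_append, W_cons, W_nil, mul_one, mul_assoc] using this
  | x :: y :: a =>
    simp only [List.cons_append, List.cons.injEq] at hw'
    obtain ⟨rfl, rfl, rfl⟩ := hw'
    subst hw
    have A := D.agree (sand D.N 1 (D.e k * (D.e l * D.W v'))) (sand D.N 1 (D.q k l * D.W v'))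
      u a i j hij
      (by
        intro m
        have := ih (u ++ m :: (a ++ k :: l :: v')) (lt_len (by simp)) (u ++ m :: a) k l v'
          (by simp) hkl
        simpa only [sand_apply, W_append, W_cons, mul_assoc, one_mul] using this)
      (by
        intro h
        have := ih (u ++ j :: i :: (a ++ k :: l :: v')) (lt_cons _ _ _ h (by simp))
          (u ++ j :: i :: a) k l v' (by simp) hkl
        simpa only [sand_apply, W_append, W_cons, mul_assoc, one_mul] using this)
    have B := D.agree (sand D.N (D.W u * (D.e i * D.e j)) 1) (sand D.N (D.W u * D.q i j) 1)
      a v' k l hkl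
      (by
        intro m
        have := ih (u ++ i :: j :: (a ++ m :: v')) (lt_len (by simp)) u i j (a ++ m :: v')
          rfl hij
        simpa only [sand_apply, W_append, W_cons, mul_assoc, mul_one] using this)
      (by
        intro h
        have := ih (u ++ i :: j :: (a ++ l :: k :: v'))
          (by simpa using lt_cons (u ++ i :: j :: a) (k :: v') (l :: v') h (by simp))
          u i j (a ++ l :: k :: v') rfl hij
        simpa only [sand_apply, W_append, W_cons, mul_assoc, mul_one] using this)
    simp only [sand_apply, W_append, W_cons, mul_assoc, mul_one, one_mul] at A B ⊢
    rw [A, B]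

lemma good (w : List I) : D.Good w := by
  induction w using (List.Shortlex.wf (r := ((· < ·) : I → I → Prop)) wellFounded_lt).induction with
  | _ w ih =>
  intro u i j v hw hij
  obtain ⟨u', k, l, v', hw', hkl, hn⟩ := D.nf_of w ⟨(u, i, j, v), hw, hij⟩
  rw [N_W, hn]
  have h := hw.symm.trans hw'
  rcases List.append_eq_append_iff.1 h with ⟨a, rfl, h2⟩ | ⟨a, rfl, h2⟩
  · exact (D.confl w ih u a v i j k l v' hw h2 hij hkl).symm
  · exact D.confl w ih u' a v' k l i j v hw' h2 hkl hij

lemma N_ι (x : M) : D.N (TensorAlgebra.ι R x) = TensorAlgebra.ι R x := by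
  refine D.ι_congr (F := D.N) (G := LinearMap.id) (fun m => ?_) x
  have : D.e m = D.W [m] := by simp [W]
  rw [this, N_W, nf_of_not]
  · rfl
  · rintro ⟨⟨u, i, j, v⟩, h, -⟩
    have := congrArg List.length h
    simp at this
    omega

lemma sand_bad (x y : TensorAlgebra R M) (i j : I) (hb : D.bad i j) :
    sand D.N x y (D.e i * D.e j) = sand D.N x y (D.q i j) := by
  have h1 : ∀ u v, sand D.N (D.W u) (D.W v) (D.e i * D.e j)
      = sand D.N (D.W u) (D.W v) (D.q i j) := by
    intro u v
    have := D.good _ u i j v rfl hb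
    simpa only [sand_apply, W_append, W_cons, mul_assoc] using this
  have h2 : ∀ u, sand D.N (D.W u) y (D.e i * D.e j) = sand D.N (D.W u) y (D.q i j) := by
    intro u
    have := D.lin_ext (F := sand D.N (D.W u * (D.e i * D.e j)) 1)
      (G := sand D.N (D.W u * (D.q i j)) 1) (fun w => by
        simpa only [sand_apply, mul_assoc, mul_one] using h1 u w)
    simpa only [sand_apply, mul_assoc, mul_one] using LinearMap.congr_fun this y
  have := D.lin_ext (F := sand D.N 1 ((D.e i * D.e j) * y))
      (G := sand D.N 1 ((D.q i j) * y)) (fun w => by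
        simpa only [sand_apply, mul_assoc, one_mul] using h2 w)
  simpa only [sand_apply, mul_assoc, one_mul] using LinearMap.congr_fun this x

/-- The congruence of elements identified by `N` in all contexts. -/
def con : RingCon (TensorAlgebra R M) where
  r s t := ∀ x y, sand D.N x y s = sand D.N x y t
  iseqv := ⟨fun _ _ _ => rfl, fun h x y => (h x y).symm, fun h h' x y => (h x y).trans (h' x y)⟩
  add' h h' x y := by rw [map_add, map_add, h, h']
  mul' {a b c d} h h' x y := by
    have h1 := h x (c * y)
    have h2 := h' (x * b) y
    simp only [sand_apply, mul_assoc] at h1 h2 ⊢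
    rw [h1, h2]

theorem inj : Function.Injective (fun x : M =>
      RingQuot.mkAlgHom R (gradedUEARel R M D.g D.β D.sq) (TensorAlgebra.ι R x)) := by
  intro x y hxy
  have hrel : ∀ ⦃s t⦄, gradedUEARel R M D.g D.β D.sq s t →
      (D.con.mkₐ (α := R)) s = (D.con.mkₐ (α := R)) t := by
    intro s t h
    refine (RingCon.eq D.con).2 fun a c => ?_
    rcases h with ⟨i, j, p, q, hp, hq, rfl, rfl⟩ | ⟨k, p, hp, rfl, rfl⟩
    · rw [map_sub, map_zsmul, D.comm_of _ (D.sand_bad a c) i j p q hp hq]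
      abel
    · exact D.sq_of _ (D.sand_bad a c) k p hp
  have := congrArg (RingQuot.liftAlgHom R ⟨D.con.mkₐ (α := R), hrel⟩) hxy
  simp only [RingQuot.liftAlgHom_mkAlgHom_apply] at this
  have h := (RingCon.eq D.con).1 this 1 1
  simp only [sand_apply, one_mul, mul_one, N_ι] at h
  exact TensorAlgebra.ι_leftInverse.injective h

end PBWData

/-- Let `R` be a PID and `L` a graded Lie algebra over `R` (with squaring
operation on odd-degree classes) such that each graded piece `L_n` is a finitely generated
free `R`-module.  Then the natural map `ι : L → U(L)` into the universal enveloping algebra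
is injective. -/
theorem gradedLie_injects_into_uea (R : Type*) [CommRing R] [IsDomain R]
    [IsPrincipalIdealRing R] (M : Type*) [AddCommGroup M] [Module R M]
    (g : ℕ → Submodule R M) (hg : DirectSum.IsInternal g)
    (hfree : ∀ n, Module.Free R ↥(g n)) (hfin : ∀ n, Module.Finite R ↥(g n))
    (β : M →ₗ[R] M →ₗ[R] M) (sq : M → M)
    (hβg : ∀ i j, ∀ x ∈ g i, ∀ y ∈ g j, β x y ∈ g (i + j))
    (hsqg : ∀ k, ∀ x ∈ g (2 * k + 1), sq x ∈ g (4 * k + 2))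
    (hanti : ∀ i j, ∀ x ∈ g i, ∀ y ∈ g j, β x y = -(((-1 : ℤ) ^ (i * j)) • β y x))
    (hjac : ∀ i j, ∀ x ∈ g i, ∀ y ∈ g j, ∀ z : M,
      β x (β y z) = β (β x y) z + ((-1 : ℤ) ^ (i * j)) • β y (β x z))
    (hsq_smul : ∀ k (a : R), ∀ x ∈ g (2 * k + 1), sq (a • x) = (a * a) • sq x)
    (hsq_add : ∀ k, ∀ x ∈ g (2 * k + 1), ∀ y ∈ g (2 * k + 1),
      sq (x + y) = sq x + sq y + β x y)
    (htwo_sq : ∀ k, ∀ x ∈ g (2 * k + 1), (2 : ℤ) • sq x = β x x)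
    (hbr_sq_self : ∀ k, ∀ x ∈ g (2 * k + 1), β x (sq x) = 0)
    (heven_self : ∀ i, ∀ x ∈ g (2 * i), β x x = 0)
    (hbr_sq : ∀ k j, ∀ x ∈ g (2 * k + 1), ∀ y ∈ g j, β y (sq x) = β (β y x) x) :
    Function.Injective (fun x : M =>
      RingQuot.mkAlgHom R (gradedUEARel R M g β sq) (TensorAlgebra.ι R x)) := by
  classical
  let v := fun n => @Module.Free.chooseBasis R (g n) _ _ _ (hfree n)
  obtain ⟨_, _⟩ := exists_wellFoundedLT (Σ n, @Module.Free.ChooseBasisIndex R (g n) _ _ _ (hfree n))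
  let D : PBWData R M (Σ n, @Module.Free.ChooseBasisIndex R (g n) _ _ _ (hfree n)) :=
    { b := hg.collectedBasis v
      d := Sigma.fst
      g := g
      β := β
      sq := sq
      hbg := fun i => hg.collectedBasis_mem v i
      hspan := by
        intro n x hx
        have h1 := (v n).mem_span ⟨x, hx⟩
        have h2 := Submodule.mem_map_of_mem (f := (g n).subtype) h1
        rw [Submodule.map_span] at h2
        refine Submodule.span_mono ?_ h2
        rintro _ ⟨_, ⟨i, rfl⟩, rfl⟩
        exact ⟨⟨n, i⟩, rfl, by simp⟩
      hβg := hβg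
      hsqg := hsqg
      hanti := hanti
      hjac := hjac
      hsq_smul := hsq_smul
      hsq_add := hsq_add
      htwo_sq := htwo_sq
      hbr_sq_self := hbr_sq_self
      heven_self := heven_self
      hbr_sq := hbr_sq }
  exact D.inj
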